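/- Let r(x) = e^{x²/2} ∫_x^∞ e^{−t²/2} dt be Mill's ratio. Then the function x ↦ 1/r(x) is strictly convex on ℝ, and Sampford's inequality r(x) < 4/(3x + √(x²+8)) holds for every x > −1. -/

import Mathlib

open MeasureTheory Set

/-- Mill's ratio of the Gaussian law. -/
noncomputable def mill (x : ℝ) : ℝ :=
  Real.exp (x ^ 2 / 2) * ∫ t in Ioi x, Real.exp (-t ^ 2 / 2)

/-- The Gaussian density (without normalization) is integrable. -/
lemma integrable_exp_neg_sq_div_two : Integrable fun t : ℝ => Real.exp (-t ^ 2 / 2) := by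
  have h := integrable_exp_neg_mul_sq (b := 1 / 2) (by norm_num)
  refine h.congr (Filter.Eventually.of_forall fun t => ?_)
  simp only
  congr 1
  ring

lemma integral_Ioi_exp_neg_sq_div_two_eq_sub (x : ℝ) :
    ∫ t in Ioi x, Real.exp (-t ^ 2 / 2) =
      (∫ t in Ioi 0, Real.exp (-t ^ 2 / 2)) - ∫ t in (0 : ℝ)..x, Real.exp (-t ^ 2 / 2) := by
  rw [← intervalIntegral.integral_Ioi_sub_Ioi' (a := 0) (b := x)
    integrable_exp_neg_sq_div_two.integrableOn integrable_exp_neg_sq_div_two.integrableOn]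
  ring

lemma hasDerivAt_integral_Ioi_exp_neg_sq_div_two (x : ℝ) :
    HasDerivAt (fun y : ℝ => ∫ t in Ioi y, Real.exp (-t ^ 2 / 2)) (-Real.exp (-x ^ 2 / 2)) x := by
  have hcont : Continuous fun t : ℝ => Real.exp (-t ^ 2 / 2) := by fun_prop
  rw [funext integral_Ioi_exp_neg_sq_div_two_eq_sub]
  exact (hcont.integral_hasStrictDerivAt 0 x).hasDerivAt.const_sub _

lemma tendsto_integral_Ioi_exp_neg_sq_div_two :
    Filter.Tendsto (fun y : ℝ => ∫ t in Ioi y, Real.exp (-t ^ 2 / 2)) Filter.atTop (nhds 0) := by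
  rw [funext integral_Ioi_exp_neg_sq_div_two_eq_sub]
  have h : Filter.Tendsto (fun y : ℝ => ∫ t in (0 : ℝ)..y, Real.exp (-t ^ 2 / 2)) Filter.atTop
      (nhds (∫ t in Ioi (0 : ℝ), Real.exp (-t ^ 2 / 2))) :=
    intervalIntegral_tendsto_integral_Ioi 0 integrable_exp_neg_sq_div_two.integrableOn
      Filter.tendsto_id
  have hsub := h.const_sub (∫ t in Ioi (0 : ℝ), Real.exp (-t ^ 2 / 2))
  rwa [sub_self] at hsub

lemma mill_pos (x : ℝ) : 0 < mill x := by
  refine mul_pos (Real.exp_pos _) ?_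
  rw [setIntegral_pos_iff_support_of_nonneg_ae
    (Filter.Eventually.of_forall fun t => (Real.exp_pos _).le)
    integrable_exp_neg_sq_div_two.integrableOn]
  have hsupp : Function.support (fun t : ℝ => Real.exp (-t ^ 2 / 2)) = univ :=
    Function.support_eq_univ fun t => (Real.exp_pos _).ne'
  simp [hsupp]

/-- The differential equation `r' = x r - 1` of Mill's ratio. -/
lemma hasDerivAt_mill (x : ℝ) : HasDerivAt mill (x * mill x - 1) x := by
  have hexp : HasDerivAt (fun y : ℝ => Real.exp (y ^ 2 / 2)) (Real.exp (x ^ 2 / 2) * x) x := by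
    have h := (((hasDerivAt_id' x).fun_pow 2).div_const 2).exp
    convert h using 1
    simp
  refine (hexp.mul (hasDerivAt_integral_Ioi_exp_neg_sq_div_two x)).congr_deriv ?_
  have hinv : Real.exp (x ^ 2 / 2) * Real.exp (-x ^ 2 / 2) = 1 := by
    rw [← Real.exp_add, ← Real.exp_zero]
    congr 1
    ring
  rw [mill]
  linear_combination -hinv

lemma three_mul_add_sqrt_pos {x : ℝ} (hx : -1 < x) : 0 < 3 * x + √(x ^ 2 + 8) := by
  have hs : √(x ^ 2 + 8) ^ 2 = x ^ 2 + 8 := Real.sq_sqrt (by positivity)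
  have hs0 : 0 ≤ √(x ^ 2 + 8) := Real.sqrt_nonneg _
  by_contra! h
  nlinarith

lemma cube_add_six_mul_lt (x : ℝ) : x ^ 3 + 6 * x < √(x ^ 2 + 8) * (x ^ 2 + 2) := by
  have hs : √(x ^ 2 + 8) ^ 2 = x ^ 2 + 8 := Real.sq_sqrt (by positivity)
  refine lt_of_pow_lt_pow_left₀ 2 (by positivity) ?_
  rw [mul_pow, hs]
  nlinarith

/-- The derivative of Sampford's bound is smaller than the value prescribed by the differential
equation of Mill's ratio. -/
lemma exists_hasDerivAt_sampford {x : ℝ} (hx : -1 < x) :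
    ∃ d, HasDerivAt (fun y : ℝ => 4 / (3 * y + √(y ^ 2 + 8))) d x ∧
      d < x * (4 / (3 * x + √(x ^ 2 + 8))) - 1 := by
  have hpos := three_mul_add_sqrt_pos hx
  have hs : √(x ^ 2 + 8) ^ 2 = x ^ 2 + 8 := Real.sq_sqrt (by positivity)
  have hs0 : 0 < √(x ^ 2 + 8) := by positivity
  have hsqrt : HasDerivAt (fun y : ℝ => √(y ^ 2 + 8)) (x / √(x ^ 2 + 8)) x := by
    have h := (((hasDerivAt_id' x).fun_pow 2).add_const 8).sqrt
      (show x ^ 2 + 8 ≠ 0 by positivity)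
    convert h using 1
    simp
    field_simp
  have hden : HasDerivAt (fun y : ℝ => 3 * y + √(y ^ 2 + 8)) (3 + x / √(x ^ 2 + 8)) x := by
    simpa using ((hasDerivAt_id' x).const_mul 3).fun_add hsqrt
  refine ⟨_, (hasDerivAt_const x (4 : ℝ)).div hden hpos.ne', ?_⟩
  have hineq := cube_add_six_mul_lt x
  generalize √(x ^ 2 + 8) = s at *
  rw [← sub_pos]
  have hne : x * 3 + s ≠ 0 := by rw [mul_comm]; exact hpos.ne'
  have key : x * (4 / (3 * x + s)) - 1 - (0 * (3 * x + s) - 4 * (3 + x / s)) / (3 * x + s) ^ 2 =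
      2 * (s * (x ^ 2 + 2) - (x ^ 3 + 6 * x)) / (s * (3 * x + s) ^ 2) := by
    field_simp
    linear_combination (-2 * x - s) * hs
  rw [key]
  have := sub_pos.2 hineq
  positivity

lemma strictMonoOn_integral_Ioi_sub_sampford :
    StrictMonoOn (fun y : ℝ => (∫ t in Ioi y, Real.exp (-t ^ 2 / 2)) -
      Real.exp (-y ^ 2 / 2) * (4 / (3 * y + √(y ^ 2 + 8)))) (Ioi (-1)) := by
  have hderiv (x : ℝ) (hx : -1 < x) : ∃ d > 0, HasDerivAt
      (fun y : ℝ => (∫ t in Ioi y, Real.exp (-t ^ 2 / 2)) -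
        Real.exp (-y ^ 2 / 2) * (4 / (3 * y + √(y ^ 2 + 8)))) d x := by
    obtain ⟨d, hd, hlt⟩ := exists_hasDerivAt_sampford hx
    have hexp : HasDerivAt (fun y : ℝ => Real.exp (-y ^ 2 / 2))
        (Real.exp (-x ^ 2 / 2) * -x) x := by
      have h := (((hasDerivAt_id' x).fun_pow 2).fun_neg.div_const 2).exp
      convert h using 1
      simp
      ring
    refine ⟨_, ?_, (hasDerivAt_integral_Ioi_exp_neg_sq_div_two x).sub (hexp.mul hd)⟩
    have := mul_pos (Real.exp_pos (-x ^ 2 / 2)) (sub_pos.2 hlt)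
    linarith
  refine strictMonoOn_of_deriv_pos (convex_Ioi _) (fun x hx => ?_) fun x hx => ?_
  · obtain ⟨d, -, hd⟩ := hderiv x hx
    exact hd.continuousAt.continuousWithinAt
  · rw [interior_Ioi] at hx
    obtain ⟨d, hpos, hd⟩ := hderiv x hx
    rwa [hd.deriv]

/-- Sampford's inequality. -/
lemma mill_lt_sampford {x : ℝ} (hx : -1 < x) : mill x < 4 / (3 * x + √(x ^ 2 + 8)) := by
  have hx1 : -1 < x + 1 := by linarith
  have hlt := strictMonoOn_integral_Ioi_sub_sampford hx hx1 (lt_add_one x)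
  have hle := ge_of_tendsto tendsto_integral_Ioi_exp_neg_sq_div_two <| by
    filter_upwards [Filter.eventually_ge_atTop (x + 1)] with y hy
    have hy1 : -1 < y := hx1.trans_le hy
    have hpos := three_mul_add_sqrt_pos hy1
    exact (strictMonoOn_integral_Ioi_sub_sampford.monotoneOn hx1 hy1 hy).trans
      (sub_le_self _ (by positivity))
  have h := mul_lt_mul_of_pos_left (sub_neg.1 (hlt.trans_le hle)) (Real.exp_pos (x ^ 2 / 2))
  have hinv : Real.exp (x ^ 2 / 2) * Real.exp (-x ^ 2 / 2) = 1 := by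
    rw [← Real.exp_add, ← Real.exp_zero]
    congr 1
    ring
  rwa [← mul_assoc, hinv, one_mul] at h

lemma sampford_lt_one_div_mill (x : ℝ) : (3 * x + √(x ^ 2 + 8)) / 4 < 1 / mill x := by
  rcases lt_or_ge (-1) x with hx | hx
  · have h := one_div_lt_one_div_of_lt (mill_pos x) (mill_lt_sampford hx)
    rwa [one_div_div] at h
  · have hs : √(x ^ 2 + 8) ≤ -(3 * x) := Real.sqrt_le_iff.2 ⟨by linarith, by nlinarith⟩
    have := one_div_pos.2 (mill_pos x)
    linarith

lemma hasDerivAt_one_div_mill (x : ℝ) :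
    HasDerivAt (fun y => 1 / mill y) (1 / mill x * (1 / mill x - x)) x := by
  have hne := (mill_pos x).ne'
  refine ((hasDerivAt_const x (1 : ℝ)).div (hasDerivAt_mill x) hne).congr_deriv ?_
  field_simp
  ring

lemma strictConvexOn_one_div_mill : StrictConvexOn ℝ univ (fun x => 1 / mill x) := by
  refine strictConvexOn_univ_of_deriv2_pos
    (continuous_iff_continuousAt.2 fun x => (hasDerivAt_one_div_mill x).continuousAt) fun x => ?_
  have hderiv : deriv (fun x => 1 / mill x) = fun x => 1 / mill x * (1 / mill x - x) :=
    funext fun x => (hasDerivAt_one_div_mill x).deriv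
  have hd := hasDerivAt_one_div_mill x
  rw [Function.iterate_succ_apply, Function.iterate_one, hderiv,
    (hd.fun_mul (hd.fun_sub (hasDerivAt_id' x))).deriv]
  have hlt := sampford_lt_one_div_mill x
  have hpos := one_div_pos.2 (mill_pos x)
  have hs : √(x ^ 2 + 8) ^ 2 = x ^ 2 + 8 := Real.sq_sqrt (by positivity)
  have hs0 : 0 < √(x ^ 2 + 8) := by positivity
  generalize 1 / mill x = l at *
  generalize √(x ^ 2 + 8) = s at *
  have hfactor : 0 < (l - (3 * x + s) / 4) * (l - (3 * x - s) / 4) :=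
    mul_pos (by linarith) (by linarith)
  have := mul_pos hpos hfactor
  linear_combination 2 * this - l / 8 * hs

/-- Corollary: `1/r` is strictly convex on `ℝ`, and Sampford's inequality holds
for `x > -1`, where `r` is Mill's ratio. -/
theorem mill_convexity_and_sampford :
    StrictConvexOn ℝ univ (fun x => 1 / mill x) ∧
    ∀ x : ℝ, -1 < x → mill x < 4 / (3 * x + Real.sqrt (x ^ 2 + 8)) :=
  ⟨strictConvexOn_one_div_mill, fun _ hx => mill_lt_sampford hx⟩
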